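/- arXiv:2108.09390 — 2 statements merged into one kernel-verified Lean document; each statement's English description precedes it below -/
import Mathlib

section
/- Let G be a group with finite generating set X and normal form η such that the solution language of every finite system of equations in G with respect to η is EDT0L. Let H be a finite index subgroup of G, T a right transversal of H in G, Z the Schreier generating set for H, and ζ the Schreier normal form for (H, Z) inherited from η. Then the solution language of every finite system of equations in H with respect to ζ is EDT0L. -/
namespace Paper

/-- Apply a letterwise substitution (i.e. the endomorphism of the free monoid `C*`
determined by its action on letters) to a word over `C`. -/
def subApply {C : Type*} (f : C → List C) (w : List C) : List C := (w.map f).flatten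

/-- An EDT0L system: a finite extended alphabet `C`, an identification of some letters of
`C` with terminal letters of the alphabet `α` (injectively, modelling `Σ ⊆ C`), a start
word over `C`, and a rational control: a regular language over a finite set of letterwise
substitutions (endomorphisms of `C*`), a word of endomorphisms acting by composition. -/
structure EDT0LSystem (α : Type*) where
  C : Type
  finC : Fintype C
  term : C → Option α
  term_inj : ∀ c c' a, term c = some a → term c' = some a → c = c'
  start : List C
  ι : Type
  finι : Fintype ι
  tab : ι → C → List C
  control : Language ι
  control_reg : control.IsRegular

/-- The endomorphism of `C*` given by a word of basic endomorphisms, applied to `w`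
(the word `φ₁φ₂⋯φₖ` acts as `φ₁∘φ₂∘⋯∘φₖ`, functions written on the right). -/
def EDT0LSystem.apply {α : Type*} (S : EDT0LSystem α) (φs : List S.ι) (w : List S.C) :
    List S.C :=
  φs.foldl (fun v i => subApply (S.tab i) v) w

/-- The language accepted by an EDT0L system: `{ωφ : φ ∈ R} ∩ Σ*`. -/
def EDT0LSystem.accepts {α : Type*} (S : EDT0LSystem α) : Language α :=
  { w | ∃ φs ∈ S.control, (S.apply φs S.start).map S.term = w.map Option.some }

/-- A language is EDT0L if it is accepted by some EDT0L system. -/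
def IsEDT0L {α : Type*} (L : Language α) : Prop := ∃ S : EDT0LSystem α, S.accepts = L

/-- Evaluate a word over the alphabet `Σ ∪ Σ⁻¹` (a letter is a generator index together
with a sign) in a group. -/
def evalWord {G : Type*} [Group G] {ι : Type*} (gen : ι → G) (w : List (ι × Bool)) : G :=
  (w.map fun l => if l.2 then gen l.1 else (gen l.1)⁻¹).prod

/-- The word length of `g` with respect to the generating set `gen`. -/
noncomputable def wordLength {G : Type*} [Group G] {ι : Type*} (gen : ι → G) (g : G) : ℕ :=
  sInf {n | ∃ w : List (ι × Bool), evalWord gen w = g ∧ w.length = n}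

/-- A normal form is quasigeodesic if `|η(g)| ≤ λ·|g| + λ` for some `λ > 0`. -/
def IsQuasigeodesicNF {G : Type*} [Group G] {ι : Type*} (gen : ι → G)
    (η : G → List (ι × Bool)) : Prop :=
  ∃ lam : ℝ, 0 < lam ∧ ∀ g : G, ((η g).length : ℝ) ≤ lam * (wordLength gen g) + lam

/-- A normal form is regular if its image is a regular language. -/
def IsRegularNF {G : Type*} [Group G] {ι : Type*} (η : G → List (ι × Bool)) : Prop :=
  Language.IsRegular (Set.range η : Language (ι × Bool))

/-- A subset of a group is rational if it is the image of a regular language under the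
evaluation map from the free monoid on a finite monoid generating set. -/
def IsRationalSubset {G : Type*} [Group G] (A : Set G) : Prop :=
  ∃ (ι : Type) (_ : Fintype ι) (gen : ι → G) (L : Language ι),
    Submonoid.closure (Set.range gen) = ⊤ ∧ L.IsRegular ∧
      A = (fun w : List ι => (w.map gen).prod) '' L

/-- A subset of a group is recognisable if its full preimage under the evaluation map
from the free monoid on a finite monoid generating set is a regular language. -/
def IsRecognisableSubset {G : Type*} [Group G] (A : Set G) : Prop :=
  ∃ (ι : Type) (_ : Fintype ι) (gen : ι → G),
    Submonoid.closure (Set.range gen) = ⊤ ∧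
      Language.IsRegular ({w : List ι | (w.map gen).prod ∈ A} : Language ι)

/-- The word `w₁ # w₂ # ⋯ # wₘ` over `β ⊕ {#}`. -/
def hashWord {β : Type*} {m : ℕ} (ws : Fin m → List β) : List (β ⊕ Unit) :=
  List.intercalate [Sum.inr ()] (List.ofFn fun i => (ws i).map Sum.inl)

/-- `g : Fin m → G` is a solution of the system `E ⊆ G ∗ F_X` of equations. -/
def SolvesSystem {G : Type*} [Group G] {m : ℕ}
    (E : Set (Monoid.Coprod G (FreeGroup (Fin m)))) (g : Fin m → G) : Prop :=
  ∀ e ∈ E, Monoid.Coprod.lift (MonoidHom.id G) (FreeGroup.lift g) e = 1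

/-- The solution language of a system of equations with constraints, w.r.t. a normal form. -/
def solutionLanguageC {G : Type*} [Group G] {ι : Type*} (η : G → List (ι × Bool)) {m : ℕ}
    (E : Set (Monoid.Coprod G (FreeGroup (Fin m)))) (Rc : Fin m → Set G) :
    Language ((ι × Bool) ⊕ Unit) :=
  { w | ∃ g : Fin m → G, SolvesSystem E g ∧ (∀ i, g i ∈ Rc i) ∧
      w = hashWord fun i => η (g i) }

/-- The solution language of a system of equations, w.r.t. a normal form. -/
def solutionLanguage {G : Type*} [Group G] {ι : Type*} (η : G → List (ι × Bool)) {m : ℕ}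
    (E : Set (Monoid.Coprod G (FreeGroup (Fin m)))) : Language ((ι × Bool) ⊕ Unit) :=
  solutionLanguageC η E fun _ => Set.univ

/-- Evaluate a twisted word (a word over `H ∪ (F_X × Ω)`) at the assignment `g` of the
variables: each letter `(u, ψ)` becomes `ψ(uφ)` where `φ` is the homomorphism `F_X → H`
determined by `g`, and the word is multiplied out in `H`. -/
def twistedEval {H : Type*} [Group H] {m : ℕ} (Ω : Subgroup (MulAut H)) (g : Fin m → H)
    (w : List (H ⊕ (FreeGroup (Fin m) × Ω))) : H :=
  (w.map (Sum.elim id fun p => (p.2 : MulAut H) (FreeGroup.lift g p.1))).prod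

/-- The solution language of a system of `Ω`-twisted equations with constraints. -/
def twistedSolutionLanguage {H : Type*} [Group H] {ι : Type*} (Ω : Subgroup (MulAut H))
    (η : H → List (ι × Bool)) {m : ℕ}
    (E : Set (List (H ⊕ (FreeGroup (Fin m) × Ω)))) (Rc : Fin m → Set H) :
    Language ((ι × Bool) ⊕ Unit) :=
  { w | ∃ g : Fin m → H, (∀ e ∈ E, twistedEval Ω g e = 1) ∧ (∀ i, g i ∈ Rc i) ∧
      w = hashWord fun i => η (g i) }


/-- The Schreier rewriting of a word: given a transversal-representative function `rep`
and a word `a₁⋯aₘ` over `Σ ∪ Σ⁻¹`, starting at the transversal element `t`, produce the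
word `(t₀a₁(t₀a₁)̄⁻¹)(t₁a₂(t₁a₂)̄⁻¹)⋯` over the Schreier generators `Z ∪ Z⁻¹`; a Schreier
letter is a formal symbol indexed by a pair `(t, x) ∈ T × Σ` together with a sign
(a positive letter `((t,x),true)` stands for `tx(t̄x̄)⁻¹`, and `((t',x),false)` for its
inverse, which arises when the letter read is `x⁻¹`). -/
def schreierWord {G : Type} [Group G] {ι : Type} (rep : G → G) (gen : ι → G) :
    G → List (ι × Bool) → List ((G × ι) × Bool)
  | _, [] => []
  | t, (x, b) :: rest =>
    let a : G := if b then gen x else (gen x)⁻¹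
    let t' := rep (t * a)
    (if b then ((t, x), true) else ((t', x), false)) :: schreierWord rep gen t' rest

/-- The value in `G` of a formal Schreier letter: `((t,x),true) ↦ tx(t̄x̄)⁻¹` and
`((t,x),false)` is its inverse. -/
def schreierEval {G : Type} [Group G] {ι : Type} (rep : G → G) (gen : ι → G)
    (l : (G × ι) × Bool) : G :=
  if l.2 then l.1.1 * gen l.1.2 * (rep (l.1.1 * gen l.1.2))⁻¹
  else (l.1.1 * gen l.1.2 * (rep (l.1.1 * gen l.1.2))⁻¹)⁻¹

/-- The word length of an element of `H` with respect to the Schreier generating set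
`Z = {tx(t̄x̄)⁻¹ : t ∈ T, x ∈ Σ}` (letters indexed by pairs `(t,x)` with `t` in the
transversal `T = range rep`). -/
noncomputable def schreierLength {G : Type} [Group G] {ι : Type} (rep : G → G)
    (gen : ι → G) (h : G) : ℕ :=
  sInf {n | ∃ w : List ((G × ι) × Bool), (∀ l ∈ w, l.1.1 ∈ Set.range rep) ∧
    (w.map (schreierEval rep gen)).prod = h ∧ w.length = n}

section Transduction

variable {A B Q : Type*}

/-- The state reached from `p` after reading a word, where the letter `c` acts on states
by `f c`. -/
def runStates (f : A → Q → Q) (p : Q) (v : List A) : Q := v.foldl (fun q c => f c q) p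

/-- Label every letter of a word with the state in which it is read. -/
def annotate (f : A → Q → Q) : Q → List A → List (Q × A)
  | _, [] => []
  | p, c :: v => (p, c) :: annotate f (f c p) v

theorem runStates_append (f : A → Q → Q) (p : Q) (u v : List A) :
    runStates f p (u ++ v) = runStates f (runStates f p u) v := by
  simp [runStates]

theorem annotate_append (f : A → Q → Q) (p : Q) (u v : List A) :
    annotate f p (u ++ v) = annotate f p u ++ annotate f (runStates f p u) v := by
  induction u generalizing p with
  | nil => rfl
  | cons c u ih => simp [annotate, runStates, ih]

/-- The image of a language under the letter-to-letter sequential transducer with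
transitions `δ`, partial output function `out`, initial state `q₀` and final state `q₁`. -/
def transduce (δ : A → Q → Q) (out : Q → A → Option B) (q₀ q₁ : Q) (L : Language A) :
    Language B :=
  { w | ∃ u ∈ L, runStates δ q₀ u = q₁ ∧
      (annotate δ q₀ u).map (fun x => out x.1 x.2) = w.map some }

end Transduction

section Construction

variable {A B Q : Type} (S : EDT0LSystem A)

theorem subApply_cons {C : Type*} (f : C → List C) (c : C) (v : List C) :
    subApply f (c :: v) = f c ++ subApply f v := by
  simp [subApply]

/-- The action on states of the letters of `S` before applying the endomorphism `i`, given
their action afterwards. -/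
def pullAction (i : S.ι) (f : S.C → Q → Q) : S.C → Q → Q :=
  fun c p => runStates f p (S.tab i c)

/-- The action on states of the letters of `S` read as terminal letters. -/
def termAction (δ : A → Q → Q) : S.C → Q → Q :=
  fun c p => (S.term c).elim p fun a => δ a p

/-- The action on states of the letters of `S` before applying a word of endomorphisms. -/
def wordAction (δ : A → Q → Q) : List S.ι → S.C → Q → Q
  | [] => termAction S δ
  | i :: φs => pullAction S i (wordAction δ φs)

/-- Label each endomorphism with the action on states of the letters after it. -/
def liftControl (δ : A → Q → Q) : List S.ι → List (Option S.ι × (S.C → Q → Q))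
  | [] => []
  | i :: φs => (some i, wordAction S δ φs) :: liftControl δ φs

theorem runStates_pullAction (i : S.ι) (f : S.C → Q → Q) (p : Q) (v : List S.C) :
    runStates (pullAction S i f) p v = runStates f p (subApply (S.tab i) v) := by
  induction v generalizing p with
  | nil => rfl
  | cons c v ih =>
    rw [subApply_cons, runStates_append, ← ih]
    rfl

/-- The substitution table on annotated letters; the letter `none` is the start symbol. -/
def transduceTab (q₀ : Q) :
    Option S.ι × (S.C → Q → Q) → Option (Q × S.C) → List (Option (Q × S.C))
  | (none, f), _ => (annotate f q₀ S.start).map some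
  | (some i, f), some (p, c) => (annotate f p (S.tab i c)).map some
  | (some _, _), none => [none]

theorem subApply_transduceTab (q₀ : Q) (i : S.ι) (f : S.C → Q → Q) (p : Q)
    (v : List S.C) :
    subApply (transduceTab S q₀ (some i, f)) ((annotate (pullAction S i f) p v).map some) =
      (annotate f p (subApply (S.tab i) v)).map some := by
  induction v generalizing p with
  | nil => rfl
  | cons c v ih =>
    rw [subApply_cons, annotate_append, List.map_append, ← ih]
    simp [subApply, annotate, transduceTab, pullAction]

open Classical in
/-- The automaton recognising the control of the transduced system: it checks that the
actions on states labelling the endomorphisms are consistent. -/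
noncomputable def transduceDFA (δ : A → Q → Q) (q₀ q₁ : Q) {σ : Type} (M : DFA S.ι σ) :
    DFA (Option S.ι × (S.C → Q → Q)) (Option (Option (σ × (S.C → Q → Q)))) where
  step
    | some none, (none, f) =>
      if runStates f q₀ S.start = q₁ then some (some (M.start, f)) else none
    | some (some (s, f)), (some i, f') =>
      if f = pullAction S i f' then some (some (M.step s i, f')) else none
    | _, _ => none
  start := some none
  accept := { x | ∃ s ∈ M.accept, x = some (some (s, termAction S δ)) }

theorem transduceDFA_evalFrom_none (δ : A → Q → Q) (q₀ q₁ : Q) {σ : Type} (M : DFA S.ι σ)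
    (w : List (Option S.ι × (S.C → Q → Q))) :
    (transduceDFA S δ q₀ q₁ M).evalFrom none w = none := by
  induction w with
  | nil => rfl
  | cons a w ih => exact ih

theorem transduceDFA_evalFrom_mem (δ : A → Q → Q) (q₀ q₁ : Q) {σ : Type} (M : DFA S.ι σ)
    (w : List (Option S.ι × (S.C → Q → Q))) (s : σ) (f : S.C → Q → Q) :
    (transduceDFA S δ q₀ q₁ M).evalFrom (some (some (s, f))) w ∈
        (transduceDFA S δ q₀ q₁ M).accept ↔
      ∃ φs, w = liftControl S δ φs ∧ f = wordAction S δ φs ∧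
        M.evalFrom s φs ∈ M.accept := by
  induction w generalizing s f with
  | nil =>
    constructor
    · rintro ⟨s', hs', h⟩
      simp only [DFA.evalFrom_nil, Option.some.injEq, Prod.mk.injEq] at h
      exact ⟨[], rfl, h.2, by simpa [h.1] using hs'⟩
    · rintro ⟨φs, hw, hf, hs⟩
      cases φs with
      | nil => exact ⟨s, hs, by rw [hf]; rfl⟩
      | cons i φs => simp [liftControl] at hw
  | cons a w ih =>
    rw [DFA.evalFrom_cons]
    obtain ⟨_ | i, f'⟩ := a
    · have h : (transduceDFA S δ q₀ q₁ M).step (some (some (s, f))) (none, f') = none := rfl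
      rw [h, transduceDFA_evalFrom_none]
      constructor
      · rintro ⟨_, _, h⟩
        simp at h
      · rintro ⟨φs, hw, -⟩
        cases φs <;> simp [liftControl] at hw
    · by_cases hff : f = pullAction S i f'
      · have h : (transduceDFA S δ q₀ q₁ M).step (some (some (s, f))) (some i, f') =
            some (some (M.step s i, f')) := if_pos hff
        rw [h, ih]
        constructor
        · rintro ⟨φs, rfl, rfl, hs⟩
          exact ⟨i :: φs, rfl, hff, hs⟩
        · rintro ⟨φs, hw, hf, hs⟩
          cases φs with
          | nil => simp [liftControl] at hw
          | cons j φs =>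
            simp only [liftControl, List.cons.injEq, Prod.mk.injEq, Option.some.injEq] at hw
            obtain ⟨⟨rfl, rfl⟩, rfl⟩ := hw
            exact ⟨φs, rfl, rfl, hs⟩
      · have h : (transduceDFA S δ q₀ q₁ M).step (some (some (s, f))) (some i, f') = none :=
          if_neg hff
        rw [h, transduceDFA_evalFrom_none]
        constructor
        · rintro ⟨_, _, h⟩
          simp at h
        · rintro ⟨φs, hw, hf, hs⟩
          cases φs with
          | nil => simp [liftControl] at hw
          | cons j φs =>
            simp only [liftControl, List.cons.injEq, Prod.mk.injEq, Option.some.injEq] at hw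
            obtain ⟨⟨rfl, rfl⟩, rfl⟩ := hw
            exact (hff hf).elim

/-- The control of the transduced system. -/
def transduceControl (δ : A → Q → Q) (q₀ q₁ : Q) :
    Language (Option S.ι × (S.C → Q → Q)) :=
  { w | ∃ φs ∈ S.control, runStates (wordAction S δ φs) q₀ S.start = q₁ ∧
      w = (none, wordAction S δ φs) :: liftControl S δ φs }

theorem transduceControl_isRegular [Finite Q] (δ : A → Q → Q) (q₀ q₁ : Q) :
    (transduceControl S δ q₀ q₁).IsRegular := by
  obtain ⟨σ, _, M, hM⟩ := S.control_reg
  have := S.finC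
  have := Fintype.ofFinite (S.C → Q → Q)
  refine ⟨_, inferInstance, transduceDFA S δ q₀ q₁ M, ?_⟩
  ext w
  rw [DFA.mem_accepts]
  change (transduceDFA S δ q₀ q₁ M).evalFrom (some none) w ∈ _ ↔ _
  cases w with
  | nil =>
    constructor
    · rintro ⟨_, _, h⟩
      simp at h
    · rintro ⟨φs, -, -, h⟩
      simp at h
  | cons a w =>
    rw [DFA.evalFrom_cons]
    obtain ⟨_ | i, f⟩ := a
    · by_cases hf : runStates f q₀ S.start = q₁
      · have h : (transduceDFA S δ q₀ q₁ M).step (some none) (none, f) =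
            some (some (M.start, f)) := if_pos hf
        rw [h, transduceDFA_evalFrom_mem]
        constructor
        · rintro ⟨φs, rfl, rfl, hs⟩
          exact ⟨φs, hM ▸ hs, hf, rfl⟩
        · rintro ⟨φs, hs, -, h⟩
          simp only [List.cons.injEq, Prod.mk.injEq, true_and] at h
          rw [← hM] at hs
          exact ⟨φs, h.2, h.1, hs⟩
      · have h : (transduceDFA S δ q₀ q₁ M).step (some none) (none, f) = none := if_neg hf
        rw [h, transduceDFA_evalFrom_none]
        constructor
        · rintro ⟨_, _, h⟩
          simp at h
        · rintro ⟨φs, hs, h', h⟩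
          simp only [List.cons.injEq, Prod.mk.injEq, true_and] at h
          exact (hf (h.1 ▸ h')).elim
    · have h : (transduceDFA S δ q₀ q₁ M).step (some none) (some i, f) = none := rfl
      rw [h, transduceDFA_evalFrom_none]
      constructor
      · rintro ⟨_, _, h⟩
        simp at h
      · rintro ⟨φs, -, -, h⟩
        simp at h

/-- The EDT0L system accepting the image of the language of `S` under a transducer. -/
noncomputable def transduceSystem [Finite Q] (δ : A → Q → Q) (out : Q → A → Option B)
    (hout : ∀ p a p' a' b, out p a = some b → out p' a' = some b → p = p' ∧ a = a')
    (q₀ q₁ : Q) : EDT0LSystem B where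
  C := Option (Q × S.C)
  finC := by
    have := S.finC
    exact Fintype.ofFinite _
  term x := x.bind fun y => (S.term y.2).bind (out y.1)
  term_inj := by
    rintro (_ | ⟨p, c⟩) (_ | ⟨p', c'⟩) b h h'
    · rfl
    · simp at h
    · simp at h'
    · simp only [Option.bind_some, Option.bind_eq_some_iff] at h h'
      obtain ⟨a, ha, hb⟩ := h
      obtain ⟨a', ha', hb'⟩ := h'
      obtain ⟨rfl, rfl⟩ := hout _ _ _ _ _ hb hb'
      rw [S.term_inj c c' a ha ha']
  start := [none]
  ι := Option S.ι × (S.C → Q → Q)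
  finι := by
    have := S.finC
    have := S.finι
    exact Fintype.ofFinite _
  tab := transduceTab S q₀
  control := transduceControl S δ q₀ q₁
  control_reg := transduceControl_isRegular S δ q₀ q₁

theorem foldl_liftControl (δ : A → Q → Q) (q₀ p : Q) (φs : List S.ι) (v : List S.C) :
    (liftControl S δ φs).foldl (fun v i => subApply (transduceTab S q₀ i) v)
        ((annotate (wordAction S δ φs) p v).map some) =
      (annotate (termAction S δ) p (S.apply φs v)).map some := by
  induction φs generalizing v with
  | nil => rfl
  | cons i φs ih =>
    simp only [liftControl, wordAction, List.foldl_cons]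
    rw [subApply_transduceTab, ih]
    rfl

theorem runStates_wordAction (δ : A → Q → Q) (p : Q) (φs : List S.ι) (v : List S.C) :
    runStates (wordAction S δ φs) p v = runStates (termAction S δ) p (S.apply φs v) := by
  induction φs generalizing v with
  | nil => rfl
  | cons i φs ih =>
    rw [wordAction, runStates_pullAction, ih]
    rfl

theorem runStates_termAction (δ : A → Q → Q) (p : Q) {v : List S.C} {u : List A}
    (h : v.map S.term = u.map some) :
    runStates (termAction S δ) p v = runStates δ p u := by
  induction v generalizing p u with
  | nil => cases u <;> simp_all [runStates]
  | cons c v ih =>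
    cases u with
    | nil => simp at h
    | cons a u =>
      simp only [List.map_cons, List.cons.injEq] at h
      have hc : termAction S δ c p = δ a p := by simp [termAction, h.1]
      have := ih (δ a p) h.2
      simpa only [runStates, List.foldl_cons, hc] using this

theorem map_annotate_termAction_iff (δ : A → Q → Q) (out : Q → A → Option B) (p : Q)
    (v : List S.C) (w : List B) :
    (annotate (termAction S δ) p v).map (fun y => (S.term y.2).bind (out y.1)) =
        w.map some ↔
      ∃ u : List A, v.map S.term = u.map some ∧
        (annotate δ p u).map (fun x => out x.1 x.2) = w.map some := by
  induction v generalizing p w with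
  | nil =>
    constructor
    · intro h
      exact ⟨[], rfl, h⟩
    · rintro ⟨u, hu, h⟩
      cases u with
      | nil => exact h
      | cons a u => simp at hu
  | cons c v ih =>
    cases w with
    | nil =>
      constructor
      · intro h
        simp [annotate] at h
      · rintro ⟨u, hu, h⟩
        cases u with
        | nil => simp at hu
        | cons a u => simp [annotate] at h
    | cons b w =>
      simp only [annotate, List.map_cons, List.cons.injEq, ih, Option.bind_eq_some_iff]
      constructor
      · rintro ⟨⟨a, ha, hb⟩, u, hu, h⟩
        have hc : termAction S δ c p = δ a p := by simp [termAction, ha]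
        exact ⟨a :: u, by simp [ha, hu], by simpa [annotate, hb, hc] using h⟩
      · rintro ⟨u, hu, h⟩
        cases u with
        | nil => simp at hu
        | cons a u =>
          simp only [annotate, List.map_cons, List.cons.injEq] at hu h
          have hc : termAction S δ c p = δ a p := by simp [termAction, hu.1]
          exact ⟨⟨a, hu.1, h.1⟩, u, hu.2, hc ▸ h.2⟩

theorem transduceSystem_accepts [Finite Q] (δ : A → Q → Q) (out : Q → A → Option B)
    (hout : ∀ p a p' a' b, out p a = some b → out p' a' = some b → p = p' ∧ a = a')
    (q₀ q₁ : Q) :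
    (transduceSystem S δ out hout q₀ q₁).accepts = transduce δ out q₀ q₁ S.accepts := by
  have key : ∀ φs, (transduceSystem S δ out hout q₀ q₁).apply
      ((none, wordAction S δ φs) :: liftControl S δ φs) [none] =
      (annotate (termAction S δ) q₀ (S.apply φs S.start)).map some := by
    intro φs
    rw [← foldl_liftControl S δ q₀]
    simp [EDT0LSystem.apply, transduceSystem, subApply, transduceTab]
  have hterm : (transduceSystem S δ out hout q₀ q₁).term ∘ some =
      fun y : Q × S.C => (S.term y.2).bind (out y.1) := rfl
  ext w
  constructor
  · rintro ⟨_, ⟨φs, hφs, hrun, rfl⟩, h⟩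
    erw [key φs, List.map_map, hterm, map_annotate_termAction_iff] at h
    obtain ⟨u, hu, h⟩ := h
    refine ⟨u, ⟨φs, hφs, hu⟩, ?_, h⟩
    rw [← hrun, runStates_wordAction, runStates_termAction S δ q₀ hu]
  · rintro ⟨u, ⟨φs, hφs, hu⟩, hrun, h⟩
    refine ⟨_, ⟨φs, hφs, ?_, rfl⟩, ?_⟩
    · rw [← hrun, runStates_wordAction, runStates_termAction S δ q₀ hu]
    · erw [key φs, List.map_map, hterm, map_annotate_termAction_iff]
      exact ⟨u, hu, h⟩

theorem IsEDT0L.transduce [Finite Q] {L : Language A} (hL : IsEDT0L L) (δ : A → Q → Q)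
    (out : Q → A → Option B)
    (hout : ∀ p a p' a' b, out p a = some b → out p' a' = some b → p = p' ∧ a = a')
    (q₀ q₁ : Q) : IsEDT0L (transduce δ out q₀ q₁ L) := by
  obtain ⟨S, rfl⟩ := hL
  exact ⟨transduceSystem S δ out hout q₀ q₁, transduceSystem_accepts S δ out hout q₀ q₁⟩

end Construction

section Schreier

variable {G : Type} [Group G] {ι : Type} (gen : ι → G) (rep : G → G)

/-- The value in the group of a letter of `Σ ∪ Σ⁻¹`. -/
def letterValue (l : ι × Bool) : G := if l.2 then gen l.1 else (gen l.1)⁻¹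

/-- The transitions of the Schreier transducer. -/
def schreierStep : (ι × Bool) ⊕ Unit → Set.range rep → Set.range rep
  | Sum.inl l, p => ⟨rep (p * letterValue gen l), Set.mem_range_self _⟩
  | Sum.inr _, p => p

open Classical in
/-- The output of the Schreier transducer; the separator is only read in the state `rep 1`. -/
noncomputable def schreierOut :
    Set.range rep → (ι × Bool) ⊕ Unit → Option (((G × ι) × Bool) ⊕ Unit)
  | p, Sum.inl (x, true) => some (Sum.inl ((p, x), true))
  | p, Sum.inl (x, false) => some (Sum.inl ((rep (p * (gen x)⁻¹), x), false))
  | p, Sum.inr _ => if (p : G) = rep 1 then some (Sum.inr ()) else none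

theorem map_schreierOut_annotate (p : Set.range rep) (u : List (ι × Bool)) :
    (annotate (schreierStep gen rep) p (u.map Sum.inl)).map
        (fun x => schreierOut gen rep x.1 x.2) =
      ((schreierWord rep gen p u).map Sum.inl).map some := by
  induction u generalizing p with
  | nil => rfl
  | cons l u ih =>
    obtain ⟨x, _ | _⟩ := l <;>
    · simp only [List.map_cons, annotate, ih, schreierWord]
      rfl

variable {rep} {H : Subgroup G}

theorem rep_eq_rep_iff (hrep1 : ∀ g : G, g * (rep g)⁻¹ ∈ H)
    (hrep2 : ∀ g g' : G, g * g'⁻¹ ∈ H → rep g = rep g') {g g' : G} :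
    rep g = rep g' ↔ g * g'⁻¹ ∈ H := by
  refine ⟨fun h => ?_, hrep2 g g'⟩
  have := H.mul_mem (hrep1 g) (H.inv_mem (hrep1 g'))
  rw [h] at this
  simpa [mul_assoc] using this

theorem rep_rep_mul (hrep1 : ∀ g : G, g * (rep g)⁻¹ ∈ H)
    (hrep2 : ∀ g g' : G, g * g'⁻¹ ∈ H → rep g = rep g') (g a : G) :
    rep (rep g * a) = rep (g * a) :=
  (hrep2 _ _ (by simpa [mul_assoc] using hrep1 g)).symm

theorem finite_range_rep [H.FiniteIndex]
    (hrep2 : ∀ g g' : G, g * g'⁻¹ ∈ H → rep g = rep g') : Finite (Set.range rep) := by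
  refine Finite.of_surjective (α := G ⧸ H)
    (Quotient.lift (fun g => (⟨rep g⁻¹, Set.mem_range_self _⟩ : Set.range rep)) ?_) ?_
  · intro a b hab
    have hab : a⁻¹ * b ∈ H := QuotientGroup.leftRel_apply.1 hab
    exact Subtype.ext (hrep2 _ _ (by simpa using hab))
  · rintro ⟨_, g, rfl⟩
    exact ⟨QuotientGroup.mk g⁻¹, Subtype.ext (congrArg rep (inv_inv g))⟩

theorem runStates_schreierStep (hrep1 : ∀ g : G, g * (rep g)⁻¹ ∈ H)
    (hrep2 : ∀ g g' : G, g * g'⁻¹ ∈ H → rep g = rep g') (g : G) (u : List (ι × Bool)) :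
    runStates (schreierStep gen rep) ⟨rep g, Set.mem_range_self _⟩ (u.map Sum.inl) =
      ⟨rep (g * evalWord gen u), Set.mem_range_self _⟩ := by
  induction u generalizing g with
  | nil => simp [runStates, evalWord]
  | cons l u ih =>
    have h : schreierStep gen rep (Sum.inl l) ⟨rep g, Set.mem_range_self _⟩ =
        ⟨rep (g * letterValue gen l), Set.mem_range_self _⟩ :=
      Subtype.ext (rep_rep_mul hrep1 hrep2 _ _)
    have h' := ih (g * letterValue gen l)
    simp only [runStates, List.map_cons, List.foldl_cons, h] at h' ⊢
    rw [h']
    simp [evalWord, letterValue, mul_assoc]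

theorem schreierOut_injective (hrep1 : ∀ g : G, g * (rep g)⁻¹ ∈ H)
    (hrep2 : ∀ g g' : G, g * g'⁻¹ ∈ H → rep g = rep g') (p : Set.range rep)
    (a : (ι × Bool) ⊕ Unit) (p' : Set.range rep) (a' : (ι × Bool) ⊕ Unit)
    (b : ((G × ι) × Bool) ⊕ Unit) (h : schreierOut gen rep p a = some b)
    (h' : schreierOut gen rep p' a' = some b) : p = p' ∧ a = a' := by
  have heq := h.trans h'.symm
  obtain ⟨_, g, rfl⟩ := p
  obtain ⟨_, g', rfl⟩ := p'
  rcases a with ⟨x, _ | _⟩ | _ <;> rcases a' with ⟨x', _ | _⟩ | _ <;>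
    simp only [schreierOut, Option.some.injEq, Sum.inl.injEq, Prod.mk.injEq] at heq
  · obtain ⟨⟨heq, rfl⟩, -⟩ := heq
    rw [rep_rep_mul hrep1 hrep2, rep_rep_mul hrep1 hrep2,
      rep_eq_rep_iff hrep1 hrep2] at heq
    exact ⟨Subtype.ext (hrep2 _ _ (by simpa using heq)), rfl⟩
  · simp at heq
  · split_ifs at heq
    simp at heq
  · simp at heq
  · obtain ⟨⟨heq, rfl⟩, -⟩ := heq
    exact ⟨Subtype.ext heq, rfl⟩
  all_goals split_ifs at heq with h₁ h₂ h₂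
  · simp at heq
  · simp at heq
  · simp at heq
  · exact ⟨Subtype.ext (h₁.trans h₂.symm), rfl⟩
  · simp [schreierOut, h₁] at h

theorem map_some_append_eq_iff {B : Type*} (x w : List B) (y : List (Option B)) :
    x.map some ++ y = w.map some ↔ ∃ w', w = x ++ w' ∧ y = w'.map some := by
  constructor
  · intro h
    obtain ⟨x', w', rfl, hx, hw⟩ := List.map_eq_append_iff.1 h.symm
    rw [List.map_injective_iff.2 (Option.some_injective _) hx]
    exact ⟨w', rfl, hw.symm⟩
  · rintro ⟨w', rfl, rfl⟩
    simp

theorem transduce_intercalate_iff (hrep1 : ∀ g : G, g * (rep g)⁻¹ ∈ H)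
    (hrep2 : ∀ g g' : G, g * g'⁻¹ ∈ H → rep g = rep g')
    (us : List (List (ι × Bool))) (w : List (((G × ι) × Bool) ⊕ Unit)) :
    (runStates (schreierStep gen rep) ⟨rep 1, Set.mem_range_self _⟩
          ([Sum.inr ()].intercalate (us.map (List.map Sum.inl))) =
          ⟨rep 1, Set.mem_range_self _⟩ ∧
        (annotate (schreierStep gen rep) ⟨rep 1, Set.mem_range_self _⟩
          ([Sum.inr ()].intercalate (us.map (List.map Sum.inl)))).map
          (fun x => schreierOut gen rep x.1 x.2) = w.map some) ↔
      (∀ u ∈ us, evalWord gen u ∈ H) ∧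
        w = [Sum.inr ()].intercalate
          (us.map fun u => (schreierWord rep gen (rep 1) u).map Sum.inl) := by
  have hrun : ∀ u : List (ι × Bool),
      runStates (schreierStep gen rep) ⟨rep 1, Set.mem_range_self _⟩ (u.map Sum.inl) =
        ⟨rep 1, Set.mem_range_self _⟩ ↔ evalWord gen u ∈ H := by
    intro u
    rw [runStates_schreierStep gen hrep1 hrep2, Subtype.mk.injEq,
      rep_eq_rep_iff hrep1 hrep2]
    simp
  have hinj : Function.Injective (List.map (some : ((G × ι) × Bool) ⊕ Unit → _)) :=
    List.map_injective_iff.2 (Option.some_injective _)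
  induction us generalizing w with
  | nil => cases w <;> simp [runStates, annotate]
  | cons u us ih =>
    cases us with
    | nil =>
      simp only [List.map_cons, List.map_nil, List.intercalate_singleton, hrun,
        map_schreierOut_annotate, hinj.eq_iff, List.mem_singleton, forall_eq]
      rw [eq_comm (a := w)]
    | cons u' us =>
      have hstep : ∀ p, schreierStep gen rep (Sum.inr ()) p = p := fun _ => rfl
      simp only [List.map_cons, List.intercalate_cons_cons, List.append_assoc] at ih ⊢
      rw [List.forall_mem_cons, runStates_append, annotate_append, List.map_append,
        map_schreierOut_annotate, map_some_append_eq_iff]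
      by_cases hu : evalWord gen u ∈ H
      · rw [(hrun u).2 hu]
        simp only [List.cons_append, List.nil_append, runStates, List.foldl_cons, annotate,
          hstep, List.map_cons, schreierOut, if_true, hu, true_and] at ih ⊢
        constructor
        · rintro ⟨h, w', rfl, h'⟩
          obtain ⟨b, w'', rfl, hb, hw''⟩ := List.map_eq_cons_iff.1 h'.symm
          obtain ⟨hus, rfl⟩ := (ih w'').1 ⟨h, hw''.symm⟩
          exact ⟨hus, by rw [Option.some.inj hb]⟩
        · rintro ⟨hus, rfl⟩
          obtain ⟨h, h'⟩ := (ih _).2 ⟨hus, rfl⟩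
          exact ⟨h, _, rfl, by rw [h', List.map_cons]⟩
      · have hne : ((runStates (schreierStep gen rep) ⟨rep 1, Set.mem_range_self _⟩
            (u.map Sum.inl) : Set.range rep) : G) ≠ rep 1 :=
          fun h => hu ((hrun u).1 (Subtype.ext h))
        refine iff_of_false ?_ fun h => hu h.1.1
        rintro ⟨-, w', -, h⟩
        cases w' <;> simp [annotate, schreierOut, hne] at h

end Schreier

theorem solvesSystem_map_subtype_iff {G : Type*} [Group G] (H : Subgroup G) {m : ℕ}
    (E : Set (Monoid.Coprod H (FreeGroup (Fin m)))) (h : Fin m → H) :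
    SolvesSystem (Monoid.Coprod.map H.subtype (MonoidHom.id _) '' E)
      (fun i => (h i : G)) ↔ SolvesSystem E h := by
  have key : (Monoid.Coprod.lift (MonoidHom.id G)
      (FreeGroup.lift fun i => (h i : G))).comp
        (Monoid.Coprod.map H.subtype (MonoidHom.id _)) =
      H.subtype.comp (Monoid.Coprod.lift (MonoidHom.id H) (FreeGroup.lift h)) := by
    ext <;> simp
  simp only [SolvesSystem, Set.forall_mem_image]
  refine forall₂_congr fun e _ => ?_
  rw [← MonoidHom.comp_apply, key, MonoidHom.comp_apply, Subgroup.subtype_apply,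
    OneMemClass.coe_eq_one]

/-- If every finite system of equations in `G` has an EDT0L solution
language w.r.t. the normal form `η` over the generating set `Σ` (indexed by `ι`), and `H`
is a finite index subgroup with right transversal `T = range rep`, then every finite
system of equations in `H` has an EDT0L solution language w.r.t. the Schreier normal form
`ζ(h) = schreierWord rep gen (rep 1) (η h)` over the Schreier generating set. -/
theorem edt0l_finite_index_subgroup {G : Type} [Group G]
    {ι : Type} [Fintype ι] (gen : ι → G)
    (hgen : Subgroup.closure (Set.range gen) = ⊤)
    (η : G → List (ι × Bool)) (hη : ∀ g, evalWord gen (η g) = g)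
    (hGsys : ∀ (m : ℕ) (E : Set (Monoid.Coprod G (FreeGroup (Fin m)))), E.Finite →
      IsEDT0L (solutionLanguage η E))
    (H : Subgroup G) [H.FiniteIndex] (rep : G → G)
    (hrep1 : ∀ g : G, g * (rep g)⁻¹ ∈ H)
    (hrep2 : ∀ g g' : G, g * g'⁻¹ ∈ H → rep g = rep g') :
    ∀ (m : ℕ) (E : Set (Monoid.Coprod (↥H) (FreeGroup (Fin m)))), E.Finite →
      IsEDT0L
        (solutionLanguage (fun h : H => schreierWord rep gen (rep 1) (η (h : G))) E) := by
  intro m E hE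
  have := finite_range_rep hrep2
  have hL := (hGsys m (Monoid.Coprod.map H.subtype (MonoidHom.id _) '' E)
    (hE.image _)).transduce (schreierStep gen rep) (schreierOut gen rep)
    (schreierOut_injective gen hrep1 hrep2) ⟨rep 1, Set.mem_range_self _⟩
    ⟨rep 1, Set.mem_range_self _⟩
  convert hL using 1
  have hash : ∀ (β : Type) (ws : Fin m → List β), hashWord ws =
      [Sum.inr ()].intercalate ((List.ofFn ws).map (List.map Sum.inl)) := by
    intro β ws
    rw [hashWord, List.map_ofFn]
    rfl
  have hmap : ∀ g : Fin m → G,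
      hashWord (fun i => schreierWord rep gen (rep 1) (η (g i))) =
      [Sum.inr ()].intercalate ((List.ofFn fun i => η (g i)).map
        fun u => (schreierWord rep gen (rep 1) u).map Sum.inl) := by
    intro g
    rw [hashWord, List.map_ofFn]
    rfl
  ext w
  constructor
  · rintro ⟨h, hsol, -, rfl⟩
    refine ⟨_, ⟨fun i => h i, (solvesSystem_map_subtype_iff H E h).2 hsol,
      fun _ => Set.mem_univ _, rfl⟩, ?_⟩
    rw [hash, transduce_intercalate_iff gen hrep1 hrep2]
    exact ⟨by simp [List.mem_ofFn, hη], hmap fun i => h i⟩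
  · rintro ⟨_, ⟨g, hsol, -, rfl⟩, h⟩
    rw [hash, transduce_intercalate_iff gen hrep1 hrep2] at h
    have hg : ∀ i, g i ∈ H := fun i => by
      simpa [hη] using h.1 (η (g i)) (List.mem_ofFn.2 ⟨i, rfl⟩)
    exact ⟨fun i => ⟨g i, hg i⟩, (solvesSystem_map_subtype_iff H E _).1 hsol,
      fun _ => Set.mem_univ _, h.2.trans (hmap g).symm⟩

end Paper
end

section
/- Let k ≥ 1 and equip ℤ^k with the standard generating set {a₁, …, a_k} and the standard normal form η(x₁, …, x_k) = a₁^{x₁}⋯a_k^{x_k}. Then the solution language, with respect to η, of any finite system of twisted equations with rational constraints in ℤ^k (twisting by arbitrary automorphisms of ℤ^k) is EDT0L. -/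
namespace Paper

/-- The standard normal form on `ℤᵏ` (written multiplicatively): the word
`a₁^{x₁} a₂^{x₂} ⋯ a_k^{x_k}` over the standard generators and their inverses. -/
def stdNF (k : ℕ) (x : Multiplicative (Fin k → ℤ)) : List (Fin k × Bool) :=
  (List.ofFn fun i : Fin k =>
    List.replicate ((Multiplicative.toAdd x) i).natAbs
      (i, decide (0 ≤ (Multiplicative.toAdd x) i))).flatten

/-- The standard generators of `ℤᵏ` (written multiplicatively). -/
def stdGen (k : ℕ) : Fin k → Multiplicative (Fin k → ℤ) :=
  fun i => Multiplicative.ofAdd (Pi.single i 1)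

/-! ### Rational subsets of commutative groups are semilinear -/

section Rational

variable {M σ ι : Type*} [AddCommMonoid M]

/-- `DFARun step v S p x q`: some nonempty word of total weight `x` takes the state `p` to the
state `q` in such a way that every intermediate state lies in `S`. -/
inductive DFARun (step : σ → ι → σ) (v : ι → M) (S : Set σ) : σ → M → σ → Prop
  | single (p : σ) (a : ι) : DFARun step v S p (v a) (step p a)
  | cons (p q : σ) (a : ι) (x : M) : step p a ∈ S → DFARun step v S (step p a) x q →
      DFARun step v S p (v a + x) q

variable {step : σ → ι → σ} {v : ι → M} {S T : Set σ} {p q r s : σ} {x y : M}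

theorem DFARun.mono (hST : S ⊆ T) (h : DFARun step v S p x q) : DFARun step v T p x q := by
  induction h with
  | single p a => exact .single p a
  | cons p q a x ha _ ih => exact .cons p q a x (hST ha) ih

theorem DFARun.trans (hr : r ∈ S) (h : DFARun step v S p x r) (h' : DFARun step v S r y q) :
    DFARun step v S p (x + y) q := by
  induction h with
  | single p a => exact .cons p q a y hr h'
  | cons p r a x ha _ ih => rw [add_assoc]; exact .cons p q a _ ha (ih hr h')

theorem DFARun.loops_trans (hs : s ∈ S) (h : DFARun step v S s y q)
    (hx : x ∈ AddSubmonoid.closure {z | DFARun step v S s z s}) :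
    DFARun step v S s (x + y) q := by
  induction hx using AddSubmonoid.closure_induction generalizing y with
  | mem z hz => exact DFARun.trans hs hz h
  | zero => simpa using h
  | add a b _ _ iha ihb => rw [add_assoc]; exact iha (ihb h)

theorem dfaRun_insert_iff : DFARun step v (insert s S) p x q ↔ DFARun step v S p x q ∨
    ∃ a b c, DFARun step v S p a s ∧
      b ∈ AddSubmonoid.closure {z | DFARun step v S s z s} ∧ DFARun step v S s c q ∧
      x = a + (b + c) := by
  constructor
  · intro h
    induction h with
    | single p a => exact .inl (.single p a)
    | cons p q a x ha _ ih =>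
      rcases ih with h | ⟨b, c, d, hb, hc, hd, rfl⟩
      · rcases ha with ha | ha
        · refine .inr ⟨v a, 0, x, ha ▸ .single p a, zero_mem _, ha ▸ h, by simp⟩
        · exact .inl (.cons p q a x ha h)
      · refine .inr ?_
        rcases ha with ha | ha
        · refine ⟨v a, b + c, d, ha ▸ .single p a, add_mem ?_ hc, hd, by simp [add_assoc]⟩
          exact AddSubmonoid.subset_closure (by simpa [ha] using hb)
        · exact ⟨v a + b, c, d, .cons p s a b ha hb, hc, hd, by simp [add_assoc]⟩
  · have hS : S ⊆ insert s S := Set.subset_insert s S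
    rintro (h | ⟨a, b, c, ha, hb, hc, rfl⟩)
    · exact h.mono hS
    · refine (ha.mono hS).trans (Set.mem_insert s S)
        ((hc.mono hS).loops_trans (Set.mem_insert s S) ?_)
      exact AddSubmonoid.closure_mono (fun z hz => DFARun.mono hS hz) hb

theorem dfaRun_empty_iff : DFARun step v ∅ p x q ↔ ∃ a, step p a = q ∧ v a = x := by
  constructor
  · rintro (⟨_, a⟩ | ⟨_, _, _, _, h, _⟩)
    · exact ⟨a, rfl, rfl⟩
    · exact h.elim
  · rintro ⟨a, rfl, rfl⟩
    exact .single p a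

theorem isSemilinearSet_dfaRun [Finite ι] (hS : S.Finite) (p q : σ) :
    IsSemilinearSet {x | DFARun step v S p x q} := by
  induction S, hS using Set.Finite.induction_on generalizing p q with
  | empty =>
    simp_rw [dfaRun_empty_iff]
    exact .of_finite ((Set.toFinite {a | step p a = q}).image v)
  | @insert s S _ _ ih =>
    convert! (ih p q).union ((ih p s).add ((ih s s).closure.add (ih s q))) using 1
    ext x
    simp only [Set.mem_ofPred_eq, dfaRun_insert_iff, Set.mem_union, Set.mem_add, SetLike.mem_coe]
    refine or_congr_right ⟨?_, ?_⟩
    · rintro ⟨a, b, c, ha, hb, hc, rfl⟩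
      exact ⟨a, ha, b + c, ⟨b, hb, c, hc, rfl⟩, rfl⟩
    · rintro ⟨a, ha, _, ⟨b, hb, c, hc, rfl⟩, rfl⟩
      exact ⟨a, b, c, ha, hb, hc, rfl⟩

theorem dfaRun_univ_iff : DFARun step v Set.univ p x q ↔
    ∃ w : List ι, w ≠ [] ∧ w.foldl step p = q ∧ (w.map v).sum = x := by
  constructor
  · intro h
    induction h with
    | single p a => exact ⟨[a], by simp, by simp, by simp⟩
    | cons p q a x _ _ ih =>
      obtain ⟨w, _, rfl, rfl⟩ := ih
      exact ⟨a :: w, by simp, by simp, by simp⟩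
  · rintro ⟨w, hw, rfl, rfl⟩
    induction w generalizing p with
    | nil => exact (hw rfl).elim
    | cons a w ih =>
      rcases eq_or_ne w [] with rfl | h
      · simpa using DFARun.single p a
      · exact .cons p _ a _ trivial (ih h)

/-- The image of a regular language in a commutative monoid is semilinear. -/
theorem isSemilinearSet_image_of_isRegular [Finite ι] {L : Language ι} (hL : L.IsRegular)
    (v : ι → M) : IsSemilinearSet ((fun w : List ι => (w.map v).sum) '' L) := by
  classical
  obtain ⟨σ, _, A, rfl⟩ := hL
  have h₁ : IsSemilinearSet (⋃ q ∈ A.accept, {x | DFARun A.step v Set.univ A.start x q}) :=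
    .biUnion (Set.toFinite _) fun q _ => isSemilinearSet_dfaRun Set.finite_univ _ _
  have h₂ : IsSemilinearSet {x : M | x = 0 ∧ A.start ∈ A.accept} :=
    .of_finite ((Set.finite_singleton 0).subset fun x hx => hx.1)
  convert! h₁.union h₂ using 1
  ext x
  simp only [Set.mem_union, Set.mem_iUnion, Set.mem_ofPred_eq, dfaRun_univ_iff,
    exists_prop]
  constructor
  · rintro ⟨w, hw, rfl⟩
    rcases eq_or_ne w [] with rfl | h
    · exact .inr ⟨rfl, hw⟩
    · exact .inl ⟨_, hw, w, h, rfl, rfl⟩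
  · rintro (⟨_, hq, w, _, rfl, rfl⟩ | ⟨rfl, h⟩)
    · exact ⟨w, hq, rfl⟩
    · exact ⟨[], h, rfl⟩

theorem IsRationalSubset.isSemilinearSet {M : Type*} [AddCommGroup M]
    {A : Set (Multiplicative M)} (hA : IsRationalSubset A) :
    IsSemilinearSet (Multiplicative.ofAdd ⁻¹' A) := by
  obtain ⟨ι, _, gen, L, -, hL, rfl⟩ := hA
  exact isSemilinearSet_image_of_isRegular hL fun i => (gen i).toAdd

end Rational

/-! ### Twisted equations over commutative groups are affine -/

section Affine

variable {H : Type*} [CommGroup H] {m : ℕ}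

theorem exists_monoidHom_freeGroup_lift (u : FreeGroup (Fin m)) :
    ∃ f : (Fin m → H) →* H, ∀ g, FreeGroup.lift g u = f g := by
  induction u using FreeGroup.induction_on with
  | C1 => exact ⟨1, by simp⟩
  | of i => exact ⟨Pi.evalMonoidHom _ i, by simp⟩
  | inv_of i h => obtain ⟨f, hf⟩ := h; exact ⟨f⁻¹, by simp [← hf]⟩
  | mul a b ha hb =>
    obtain ⟨f, hf⟩ := ha
    obtain ⟨f', hf'⟩ := hb
    exact ⟨f * f', by simp [hf, hf']⟩

theorem exists_twistedEval_eq (Ω : Subgroup (MulAut H))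
    (w : List (H ⊕ (FreeGroup (Fin m) × Ω))) :
    ∃ (c : H) (f : (Fin m → H) →* H), ∀ g, twistedEval Ω g w = c * f g := by
  induction w with
  | nil => exact ⟨1, 1, by simp [twistedEval]⟩
  | cons l w ih =>
    obtain ⟨c, f, hf⟩ := ih
    simp only [twistedEval] at hf
    rcases l with h | ⟨u, ψ⟩
    · exact ⟨h * c, f, fun g => by simp [twistedEval, hf, mul_assoc]⟩
    · obtain ⟨f', hf'⟩ := exists_monoidHom_freeGroup_lift (H := H) u
      refine ⟨c, (ψ : MulAut H).toMonoidHom.comp f' * f, fun g => ?_⟩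
      simp [twistedEval, hf, hf', mul_left_comm]

theorem isSemilinearSet_twistedEval {M N : Type*} [AddCommGroup M] [AddCommMonoid N]
    [AddMonoid.FG N] (Ω : Subgroup (MulAut (Multiplicative M)))
    (w : List (Multiplicative M ⊕ (FreeGroup (Fin m) × Ω))) (φ : N →+ (Fin m → M)) :
    IsSemilinearSet {y | twistedEval Ω (fun i => Multiplicative.ofAdd (φ y i)) w = 1} := by
  obtain ⟨c, f, hf⟩ := exists_twistedEval_eq Ω w
  let F : N →+ M :=
    { toFun := fun y => (f fun i => Multiplicative.ofAdd (φ y i)).toAdd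
      map_zero' := by
        change _ = (1 : Multiplicative M).toAdd
        rw [← map_one f]
        simp only [map_zero, Pi.zero_apply, ofAdd_zero]
        rfl
      map_add' := fun y z => by
        rw [← toAdd_mul, ← map_mul]
        simp only [map_add, Pi.add_apply, ofAdd_add]
        rfl }
  convert! isSemilinearSet_setOfPred_eq c.toAdd 0 F (0 : N →+ M) using 1
  ext y
  simp only [Set.mem_ofPred_eq, hf, AddMonoidHom.zero_apply, add_zero]
  rw [← Multiplicative.toAdd.injective.eq_iff]
  rfl

end Affine

/-! ### EDT0L languages from semilinear sets of exponents -/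

theorem subApply_subApply {C : Type*} (f g : C → List C) (w : List C) :
    subApply g (subApply f w) = subApply (fun c => subApply g (f c)) w := by
  simp only [subApply, ← List.flatMap_def, List.flatMap_assoc]

theorem isRegular_biUnion {ι κ : Type*} {s : Set κ} (hs : s.Finite) (L : κ → Language ι)
    (hL : ∀ i ∈ s, (L i).IsRegular) :
    Language.IsRegular ({w | ∃ i ∈ s, w ∈ L i} : Language ι) := by
  induction s, hs using Set.Finite.induction_on with
  | empty =>
    refine ⟨Unit, inferInstance, ⟨fun _ _ => (), (), ∅⟩, ?_⟩
    ext w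
    simp only [DFA.mem_accepts, Set.mem_empty_iff_false, false_and, exists_false]
    exact Iff.rfl
  | @insert a s _ _ ih =>
    have h := (hL a (Set.mem_insert a s)).add
      (ih fun i hi => hL i (Set.mem_insert_of_mem a hi))
    exact (congrArg Language.IsRegular (Set.ext fun w => Set.exists_mem_insert)).mpr h

/-- The words consisting of letters in `P` followed by one final letter `b ∉ P`. -/
theorem isRegular_append_singleton {ι : Type*} (P : Set ι) (b : ι) (hb : b ∉ P) :
    Language.IsRegular ({w | ∃ u : List ι, (∀ l ∈ u, l ∈ P) ∧ w = u ++ [b]} : Language ι) := by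
  classical
  let A : DFA ι (Option Bool) :=
    { step := fun q l => if q = some false then
        (if l ∈ P then some false else if l = b then some true else none) else none
      start := some false
      accept := {some true} }
  have key : ∀ w, A.eval w = some false ↔ ∀ l ∈ w, l ∈ P := by
    intro w
    induction w using List.reverseRecOn with
    | nil => simp [A]
    | append_singleton w l ih =>
      rw [DFA.eval_append_singleton]
      simp only [List.forall_mem_append, ← ih, List.forall_mem_singleton]
      simp only [A]
      split_ifs <;> simp_all
  refine ⟨Option Bool, inferInstance, A, ?_⟩
  ext w
  rw [DFA.mem_accepts]
  change A.eval w = some true ↔ ∃ u : List ι, (∀ l ∈ u, l ∈ P) ∧ w = u ++ [b]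
  induction w using List.reverseRecOn with
  | nil => simp [A]
  | append_singleton w l _ =>
    rw [DFA.eval_append_singleton]
    have hA : A.step (A.eval w) l = some true ↔ A.eval w = some false ∧ l = b := by
      simp only [A]
      split_ifs <;> simp_all
      rintro rfl
      exact hb ‹_›
    rw [hA, key]
    constructor
    · rintro ⟨h, rfl⟩
      exact ⟨w, h, rfl⟩
    · rintro ⟨u, hu, h⟩
      obtain ⟨rfl, h⟩ := List.append_inj' h rfl
      exact ⟨hu, by simpa using h⟩

section Fill

variable {α D : Type*}

/-- Replace every variable `d` in a word with variables by the power `(letter d) ^ (y d)`. -/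
def fillWord (letter : D → α) (y : D → ℕ) (w : List (α ⊕ D)) : List α :=
  w.flatMap (Sum.elim (fun a => [a]) fun d => List.replicate (y d) (letter d))

/-- The substitution `d ↦ (letter d) ^ (y d) d`. -/
def pumpSub (letter : D → α) (y : D → ℕ) : α ⊕ D → List (α ⊕ D) :=
  Sum.elim (fun a => [.inl a]) fun d => List.replicate (y d) (.inl (letter d)) ++ [.inr d]

/-- The substitution `d ↦ (letter d) ^ (y d)`. -/
def finalSub (letter : D → α) (y : D → ℕ) : α ⊕ D → List (α ⊕ D) :=
  Sum.elim (fun a => [.inl a]) fun d => List.replicate (y d) (.inl (letter d))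

variable (letter : D → α)

theorem subApply_finalSub (y : D → ℕ) (w : List (α ⊕ D)) :
    subApply (finalSub letter y) w = (fillWord letter y w).map .inl := by
  induction w with
  | nil => rfl
  | cons c w ih =>
    simp only [subApply, fillWord] at ih
    rcases c with a | d <;> simp [subApply, fillWord, finalSub] at ih ⊢ <;> simp [ih]

theorem subApply_replicate_inl (f : α ⊕ D → List (α ⊕ D)) (hf : ∀ a, f (.inl a) = [.inl a])
    (n : ℕ) (a : α) (w : List (α ⊕ D)) :
    subApply f (List.replicate n (.inl a) ++ w) = List.replicate n (.inl a) ++ subApply f w := by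
  induction n with
  | zero => rfl
  | succ n ih =>
    rw [List.replicate_succ, List.cons_append, List.cons_append, ← ih]
    simp [subApply, hf]

theorem subApply_pumpSub_pumpSub (y z : D → ℕ) (w : List (α ⊕ D)) :
    subApply (pumpSub letter z) (subApply (pumpSub letter y) w) =
      subApply (pumpSub letter (y + z)) w := by
  rw [subApply_subApply]
  congr 1
  funext c
  rcases c with a | d
  · simp [pumpSub, subApply]
  · simp only [pumpSub, Sum.elim_inr]
    rw [subApply_replicate_inl _ (fun _ => rfl)]
    simp [subApply, ← List.append_assoc]

theorem subApply_pumpSub_zero (w : List (α ⊕ D)) : subApply (pumpSub letter 0) w = w := by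
  have h : pumpSub letter 0 = fun c => [c] := by
    funext c
    rcases c with a | d <;> simp [pumpSub]
  rw [h, subApply, ← List.flatMap_def, List.flatMap_singleton']

theorem subApply_finalSub_pumpSub (y z : D → ℕ) (w : List (α ⊕ D)) :
    subApply (finalSub letter z) (subApply (pumpSub letter y) w) =
      subApply (finalSub letter (y + z)) w := by
  rw [subApply_subApply]
  congr 1
  funext c
  rcases c with a | d
  · simp [pumpSub, finalSub, subApply]
  · simp only [pumpSub, Sum.elim_inr]
    rw [subApply_replicate_inl _ (fun _ => rfl)]
    simp [subApply, finalSub]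

theorem foldl_subApply_pumpSub (u : List (D → ℕ)) (w : List (α ⊕ D)) :
    u.foldl (fun v y => subApply (pumpSub letter y) v) w = subApply (pumpSub letter u.sum) w := by
  induction u using List.reverseRecOn with
  | nil => simp [subApply_pumpSub_zero]
  | append_singleton u y ih => simp [ih, subApply_pumpSub_pumpSub]

end Fill

/-- Filling the variables of a fixed word with exponents from a semilinear set gives an EDT0L
language. -/
theorem isEDT0L_fillWord {α D : Type} [Fintype α] [Fintype D] (letter : D → α)
    (skel : List (α ⊕ D)) {T : Set (D → ℕ)} (hT : IsSemilinearSet T) :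
    IsEDT0L ((fun y => fillWord letter y skel) '' T : Language α) := by
  classical
  obtain ⟨S, hS, rfl⟩ := isSemilinearSet_iff.1 hT
  choose base period hperiod using fun s : S => isLinearSet_iff.1 (hS s.1 s.2)
  let I : Type := (s : S) × Option (period s)
  let pumps (s : S) : Set I := Set.range fun p : period s => ⟨s, some p⟩
  let H : EDT0LSystem α :=
    { C := α ⊕ D
      finC := inferInstance
      term := Sum.elim some fun _ => none
      term_inj := by
        rintro (c | c) (c' | c') a h h' <;> simp_all
      start := skel
      ι := I
      finι := inferInstance
      tab := fun i => match i with
        | ⟨s, none⟩ => finalSub letter (base s)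
        | ⟨_, some p⟩ => pumpSub letter p.1
      control := {w | ∃ s ∈ (Set.univ : Set S), w ∈
        ({w | ∃ u : List I, (∀ l ∈ u, l ∈ pumps s) ∧ w = u ++ [⟨s, none⟩]} : Language I)}
      control_reg := isRegular_biUnion Set.finite_univ _ fun s _ =>
        isRegular_append_singleton _ _ (by
          rintro ⟨p, hp⟩
          exact Option.some_ne_none p (eq_of_heq (Sigma.mk.inj hp).2)) }
  have happly (s : S) (v : List (period s)) :
      H.apply (v.map (fun p => (⟨s, some p⟩ : I)) ++ [⟨s, none⟩]) H.start =
        (fillWord letter ((v.map Subtype.val).sum + base s) skel).map .inl := by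
    rw [← subApply_finalSub, ← subApply_finalSub_pumpSub, ← foldl_subApply_pumpSub]
    simp only [EDT0LSystem.apply, List.foldl_append, List.foldl_map, List.foldl_cons,
      List.foldl_nil]
    rfl
  have hterm (s : S) (v : List (period s)) (w : List α) :
      (H.apply (v.map (fun p => (⟨s, some p⟩ : I)) ++ [⟨s, none⟩]) H.start).map H.term =
        w.map some ↔ fillWord letter ((v.map Subtype.val).sum + base s) skel = w := by
    rw [happly, List.map_map]
    exact (List.map_injective_iff.2 (Option.some_injective α)).eq_iff
  have hmem (s : S) (y : D → ℕ) :
      y ∈ s.1 ↔ ∃ v : List (period s), (v.map Subtype.val).sum + base s = y := by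
    rw [hperiod s, Set.mem_vadd_set]
    constructor
    · rintro ⟨z, hz, rfl⟩
      obtain ⟨l, hl, rfl⟩ := AddSubmonoid.exists_list_of_mem_closure hz
      lift l to List (period s) using hl
      exact ⟨l, add_comm _ _⟩
    · rintro ⟨v, rfl⟩
      refine ⟨_, list_sum_mem fun z hz => ?_, add_comm _ _⟩
      obtain ⟨p, -, rfl⟩ := List.mem_map.1 hz
      exact AddSubmonoid.subset_closure p.2
  refine ⟨H, ?_⟩
  ext w
  constructor
  · rintro ⟨_, ⟨s, -, u, hu, rfl⟩, hw⟩
    obtain ⟨v, rfl⟩ : ∃ v : List (period s), v.map (fun p => (⟨s, some p⟩ : I)) = u := by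
      rwa [← Set.mem_range, Set.range_list_map]
    exact ⟨_, Set.mem_sUnion.2 ⟨s.1, s.2, (hmem s _).2 ⟨v, rfl⟩⟩, (hterm s v w).1 hw⟩
  · rintro ⟨y, ⟨s, hs, hy⟩, rfl⟩
    obtain ⟨v, rfl⟩ := (hmem ⟨s, hs⟩ y).1 hy
    refine ⟨_, ⟨⟨s, hs⟩, trivial, _, ?_, rfl⟩, (hterm ⟨s, hs⟩ v _).2 rfl⟩
    intro l hl
    obtain ⟨p, -, rfl⟩ := List.mem_map.1 hl
    exact ⟨p, rfl⟩

/-! ### Normal forms of integer vectors by signed exponents -/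

theorem flatMap_intercalate {β γ : Type*} (f : β → List γ) (sep : List β) (L : List (List β)) :
    (List.intercalate sep L).flatMap f =
      List.intercalate (sep.flatMap f) (L.map (List.flatMap f)) := by
  induction L with
  | nil => rfl
  | cons a L ih =>
    cases L with
    | nil => simp [List.intercalate]
    | cons b L =>
      simp only [List.intercalate, List.map_cons, List.intersperse_cons_cons, List.flatten_cons,
        List.flatMap_append] at ih ⊢
      rw [ih]

section SignedExponents

variable {k m : ℕ}

/-- The integer vectors with positive parts `y (·, true)` and negative parts `y (·, false)`. -/
def signedVec (k m : ℕ) : ((Fin m × Fin k) × Bool → ℕ) →+ (Fin m → Fin k → ℤ) where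
  toFun y i j := (y ((i, j), true) : ℤ) - y ((i, j), false)
  map_zero' := by ext; simp
  map_add' y z := by ext; simp; ring

/-- The word whose fillings are the solution words. -/
def signedSkeleton (k m : ℕ) :
    List (((Fin k × Bool) ⊕ Unit) ⊕ ((Fin m × Fin k) × Bool)) :=
  List.intercalate [.inl (.inr ())] (List.ofFn fun i : Fin m =>
    (List.ofFn fun j : Fin k => [.inr ((i, j), true), .inr ((i, j), false)]).flatten)

theorem stdNF_of_signedVec (y : (Fin m × Fin k) × Bool → ℕ)
    (hy : ∀ p, y (p, true) = 0 ∨ y (p, false) = 0) (i : Fin m) :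
    stdNF k (Multiplicative.ofAdd (signedVec k m y i)) =
      (List.ofFn fun j : Fin k => List.replicate (y ((i, j), true)) (j, true) ++
        List.replicate (y ((i, j), false)) (j, false)).flatten := by
  unfold stdNF
  congr 2
  funext j
  have hv : signedVec k m y i j = (y ((i, j), true) : ℤ) - y ((i, j), false) := rfl
  simp only [toAdd_ofAdd, hv]
  rcases hy (i, j) with h | h
  · rw [h]
    rcases Nat.eq_zero_or_pos (y ((i, j), false)) with h' | h'
    · simp [h']
    · simp [h'.ne']
  · simp [h]

theorem fillWord_signedSkeleton (y : (Fin m × Fin k) × Bool → ℕ)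
    (hy : ∀ p, y (p, true) = 0 ∨ y (p, false) = 0) :
    fillWord (fun d => .inl (d.1.2, d.2)) y (signedSkeleton k m) =
      hashWord fun i => stdNF k (Multiplicative.ofAdd (signedVec k m y i)) := by
  simp only [fillWord, signedSkeleton, hashWord, flatMap_intercalate, stdNF_of_signedVec y hy,
    List.map_ofFn]
  congr 2
  funext i
  simp [Function.comp_def, List.flatMap_def, List.map_flatten, List.map_ofFn,
    List.flatten_flatten]

theorem exists_signedVec_eq (x : Fin m → Fin k → ℤ) :
    ∃ y, (∀ p, y (p, true) = 0 ∨ y (p, false) = 0) ∧ signedVec k m y = x := by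
  refine ⟨fun d => if d.2 then (x d.1.1 d.1.2).toNat else (-x d.1.1 d.1.2).toNat, ?_, ?_⟩
  · intro p
    simp only [if_true, Bool.false_eq_true, if_false]
    omega
  · ext i j
    simp [signedVec]

theorem isSemilinearSet_disjoint_signs {P : Type*} [Finite P] :
    IsSemilinearSet {y : P × Bool → ℕ | ∀ p, y (p, true) = 0 ∨ y (p, false) = 0} := by
  have h (d : P × Bool) : IsSemilinearSet {y : P × Bool → ℕ | y d = 0} := by
    simpa using isSemilinearSet_setOfPred_eq (0 : ℕ) 0 (Pi.evalAddMonoidHom (fun _ => ℕ) d)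
      (0 : (P × Bool → ℕ) →+ ℕ)
  convert! IsSemilinearSet.iInter fun p : P => (h (p, true)).union (h (p, false)) using 1
  ext y
  simp

end SignedExponents

/-- In `ℤᵏ` (`k ≥ 1`) with its standard generating set and standard
normal form, the solution language of any finite system of twisted equations (twisting by
arbitrary automorphisms) with rational constraints is EDT0L. -/
theorem edt0l_twisted_free_abelian (k : ℕ) (hk : 1 ≤ k) (m : ℕ)
    (E : Set (List ((Multiplicative (Fin k → ℤ)) ⊕
      (FreeGroup (Fin m) × (⊤ : Subgroup (MulAut (Multiplicative (Fin k → ℤ))))))))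
    (hE : E.Finite)
    (Rc : Fin m → Set (Multiplicative (Fin k → ℤ)))
    (hRc : ∀ i, IsRationalSubset (Rc i)) :
    IsEDT0L (twistedSolutionLanguage ⊤ (stdNF k) E Rc) := by
  let T : Set ((Fin m × Fin k) × Bool → ℕ) :=
    {y | ∀ p, y (p, true) = 0 ∨ y (p, false) = 0} ∩
    ((⋂ e ∈ E, {y | twistedEval ⊤ (fun i => Multiplicative.ofAdd (signedVec k m y i)) e = 1}) ∩
      ⋂ i, ((Pi.evalAddMonoidHom (fun _ : Fin m => Fin k → ℤ) i).comp (signedVec k m)) ⁻¹'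
        (Multiplicative.ofAdd ⁻¹' Rc i))
  have hT : IsSemilinearSet T :=
    isSemilinearSet_disjoint_signs.inter <|
      (IsSemilinearSet.biInter hE fun e _ => isSemilinearSet_twistedEval ⊤ e _).inter <|
        .iInter fun i => (hRc i).isSemilinearSet.preimage _
  suffices h : twistedSolutionLanguage ⊤ (stdNF k) E Rc =
      ((fun y => fillWord (fun d => .inl (d.1.2, d.2)) y (signedSkeleton k m)) '' T :
        Language ((Fin k × Bool) ⊕ Unit)) from h ▸ isEDT0L_fillWord _ _ hT
  ext w
  constructor
  · rintro ⟨g, hg, hgR, rfl⟩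
    obtain ⟨y, hy, hyg⟩ := exists_signedVec_eq fun i => (g i).toAdd
    have hg' : (fun i => Multiplicative.ofAdd (signedVec k m y i)) = g := by rw [hyg]; rfl
    refine ⟨y, ⟨hy, Set.mem_iInter₂.2 fun e he => ?_, Set.mem_iInter.2 fun i => ?_⟩, ?_⟩
    · rw [Set.mem_ofPred_eq, hg']
      exact hg e he
    · have := hgR i
      rw [← hg'] at this
      exact this
    · simp only [fillWord_signedSkeleton y hy, ← hg']
  · rintro ⟨y, ⟨hy, hyE, hyR⟩, rfl⟩
    refine ⟨fun i => Multiplicative.ofAdd (signedVec k m y i), fun e he => ?_, fun i => ?_,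
      fillWord_signedSkeleton y hy⟩
    · exact Set.mem_iInter₂.1 hyE e he
    · exact Set.mem_iInter.1 hyR i

end Paper
end
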